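/- Let μ be a Borel probability measure on ℝ with μ((-∞,0)) = 0, and let P_μ(K) = ∫ max(K − x, 0) dμ(x). If K ∈ ℝ satisfies μ({K}) = 0, then P_μ is differentiable at K with derivative P_μ'(K) = μ((−∞, K]) (equal to μ([0,K]) as a real number, since μ assigns no mass to negative values). -/

import Mathlib

open MeasureTheory

/-- The put payoff is differentiable in the strike away from the terminal price. -/
theorem hasDerivAt_max_sub_zero {x K : ℝ} (hx : x ≠ K) :
    HasDerivAt (fun k : ℝ => max (k - x) 0) ((Set.Iic K).indicator 1 x) K := by
  rcases lt_or_gt_of_ne hx with h | h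
  · rw [Set.indicator_of_mem (Set.mem_Iic.2 h.le)]
    refine ((hasDerivAt_id K).sub_const x).congr_of_eventuallyEq ?_
    filter_upwards [lt_mem_nhds h] with k hk
    exact max_eq_left (sub_nonneg.2 hk.le)
  · rw [Set.indicator_of_notMem (by simpa using h)]
    refine (hasDerivAt_const K (0 : ℝ)).congr_of_eventuallyEq ?_
    filter_upwards [gt_mem_nhds h] with k hk
    exact max_eq_right (sub_nonpos.2 hk.le)

/-- The put payoff is integrable against a finite measure carried by the nonnegative reals. -/
theorem integrable_max_sub_zero (μ : Measure ℝ) [IsFiniteMeasure μ]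
    (h0 : μ (Set.Iio 0) = 0) (K : ℝ) : Integrable (fun x => max (K - x) 0) μ := by
  refine Integrable.of_bound (by fun_prop) |K| ?_
  filter_upwards [measure_eq_zero_iff_ae_notMem.1 h0] with x hx
  rw [Set.mem_Iio, not_lt] at hx
  rw [Real.norm_of_nonneg (le_max_right _ _)]
  exact max_le (by linarith [le_abs_self K]) (abs_nonneg K)

/-- If `μ({K}) = 0` then the put price is differentiable at `K` with derivative
`μ((−∞, K])`. -/
theorem put_price_hasDerivAt (μ : Measure ℝ) [IsProbabilityMeasure μ]
    (h0 : μ (Set.Iio 0) = 0) (K : ℝ) (hK : μ {K} = 0) :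
    HasDerivAt (fun K : ℝ => ∫ x, max (K - x) 0 ∂μ) ((μ (Set.Iic K)).toReal) K := by
  have key := (hasDerivAt_integral_of_dominated_loc_of_lip (μ := μ) (s := Set.univ)
    (F := fun k x : ℝ => max (k - x) 0) (F' := (Set.Iic K).indicator 1)
    (bound := fun _ => (1 : ℝ)) Filter.univ_mem
    (.of_forall fun k => by fun_prop) (integrable_max_sub_zero μ h0 K)
    (measurable_one.indicator measurableSet_Iic).aestronglyMeasurable
    (.of_forall fun x => ?_) (integrable_const 1) ?_).2
  · rwa [integral_indicator_one measurableSet_Iic] at key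
  · refine LipschitzOnWith.of_dist_le_mul fun a _ b _ => ?_
    simpa [Real.dist_eq] using abs_max_sub_max_le_abs (a - x) (b - x) 0
  · filter_upwards [measure_eq_zero_iff_ae_notMem.1 hK] with x hx
    exact hasDerivAt_max_sub_zero hx
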